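/- arXiv:2503.17123 — 3 statements merged into one kernel-verified Lean document; each statement's English description precedes it below -/
import Mathlib

section
/- If Ω ≠ 0 and φ is an automorphism of the vertex-weighted blockade graph (G, Δ), then every eigenvector v of the blockade Hamiltonian H(Ω) for its minimal eigenvalue satisfies U_φ v = v exactly (with trivial phase, not merely up to a sign); equivalently, the entries satisfy v_{φ·n} = v_n for every configuration n. Consequently the entries of a ground eigenvector are constant on each orbit of the automorphism group acting on configurations. -/
/-- Number of edges `{i,j}` of `G` with both endpoints excited in configuration `n`. -/
def excitedEdgeCount {N : ℕ} (G : SimpleGraph (Fin N)) [DecidableRel G.Adj]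
    (n : Fin N → Bool) : ℕ :=
  (Finset.univ.filter fun p : Fin N × Fin N =>
    p.1 < p.2 ∧ G.Adj p.1 p.2 ∧ n p.1 = true ∧ n p.2 = true).card

/-- The blockade Hamiltonian `H(Ω)` indexed by configurations `n ∈ {0,1}^N`. -/
noncomputable def blockadeH {N : ℕ} (G : SimpleGraph (Fin N)) [DecidableRel G.Adj]
    (Δ : Fin N → ℝ) (U₀ Ω : ℝ) : Matrix (Fin N → Bool) (Fin N → Bool) ℝ :=
  Matrix.of fun n n' =>
    if n = n' then
      U₀ * (excitedEdgeCount G n : ℝ) - ∑ i, Δ i * (if n i = true then (1 : ℝ) else 0)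
    else if hammingDist n n' = 1 then Ω else 0

/-- The action of a permutation of the vertices on configurations: `(φ·n)_i = n_{φ(i)}`. -/
def confAct {N : ℕ} (φ : Equiv.Perm (Fin N)) (n : Fin N → Bool) : Fin N → Bool :=
  fun i => n (φ i)

/-- The permutation matrix `U_φ` determined by `U_φ e_n = e_{φ·n}`. -/
def permMatrix {N : ℕ} (R : Type*) [Zero R] [One R] (φ : Equiv.Perm (Fin N)) :
    Matrix (Fin N → Bool) (Fin N → Bool) R :=
  Matrix.of fun m n => if m = confAct φ n then 1 else 0

open Matrix in
/-- A real symmetric matrix all of whose eigenvalues are at least `μ` dominates `μ • 1`. -/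
theorem Matrix.IsSymm.posSemidef_sub_smul_one {ι : Type*} [Fintype ι] [DecidableEq ι]
    {A : Matrix ι ι ℝ} (hA : A.IsSymm) {μ : ℝ}
    (hmin : ∀ (c : ℝ) (w : ι → ℝ), w ≠ 0 → A *ᵥ w = c • w → μ ≤ c) :
    (A - μ • (1 : Matrix ι ι ℝ)).PosSemidef := by
  have hB : (A - μ • (1 : Matrix ι ι ℝ)).IsHermitian := by
    rw [Matrix.IsHermitian, Matrix.conjTranspose_eq_transpose_of_trivial]
    simp [hA.eq]
  rw [hB.posSemidef_iff_eigenvalues_nonneg]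
  intro i
  have h := hB.mulVec_eigenvectorBasis i
  have hne : (hB.eigenvectorBasis i : ι → ℝ) ≠ 0 := fun h0 =>
    hB.eigenvectorBasis.orthonormal.ne_zero i (by ext j; exact congrFun h0 j)
  have := hmin (hB.eigenvalues i + μ) _ hne (by
    rw [Matrix.sub_mulVec, Matrix.smul_mulVec, Matrix.one_mulVec, sub_eq_iff_eq_add] at h
    rw [h, add_smul])
  simpa using this

open Matrix in
/-- If `B` has nonpositive off-diagonal entries and is connected, a nonnegative kernel vector
vanishing at one index vanishes identically. -/
theorem Matrix.eq_zero_of_nonneg_of_mulVec_eq_zero {ι : Type*} [Fintype ι]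
    {B : Matrix ι ι ℝ} (hoff : ∀ i j, i ≠ j → B i j ≤ 0)
    (hconn : ∀ i j, Relation.ReflTransGen (fun i j => i ≠ j ∧ B i j < 0) i j)
    {w : ι → ℝ} (hw : 0 ≤ w) (hker : B *ᵥ w = 0) {i : ι} (hi : w i = 0) : w = 0 := by
  funext j
  induction hconn i j with
  | refl => exact hi
  | @tail b c _ hbc hb =>
    have hsum : ∑ k, B b k * w k = 0 := congrFun hker b
    rw [Finset.sum_eq_zero_iff_of_nonpos] at hsum
    · have := hsum c (Finset.mem_univ c)
      simpa [hbc.2.ne] using this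
    · intro k _
      by_cases hk : b = k
      · simp [← hk, show w b = 0 from hb]
      · exact mul_nonpos_of_nonpos_of_nonneg (hoff b k hk) (hw k)

open Matrix in
/-- For a positive semidefinite matrix with nonpositive off-diagonal entries, the entrywise
absolute value of a kernel vector is a kernel vector. -/
theorem Matrix.PosSemidef.mulVec_abs_eq_zero {ι : Type*} [Fintype ι]
    {B : Matrix ι ι ℝ} (hB : B.PosSemidef) (hoff : ∀ i j, i ≠ j → B i j ≤ 0)
    {w : ι → ℝ} (hker : B *ᵥ w = 0) : B *ᵥ |w| = 0 := by
  have h0 : w ⬝ᵥ (B *ᵥ w) = 0 := by simp [hker]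
  have hle : |w| ⬝ᵥ (B *ᵥ |w|) ≤ w ⬝ᵥ (B *ᵥ w) := by
    simp only [dotProduct, mulVec, Finset.mul_sum]
    refine Finset.sum_le_sum fun i _ => Finset.sum_le_sum fun j _ => ?_
    simp only [Pi.abs_apply]
    by_cases hij : i = j
    · subst hij
      exact le_of_eq (by linear_combination B i i * abs_mul_abs_self (w i))
    · have := le_abs_self (w i * w j)
      rw [abs_mul] at this
      nlinarith [hoff i j hij]
  have hge := hB.dotProduct_mulVec_nonneg |w|
  rw [← hB.dotProduct_mulVec_zero_iff]
  simp only [star_trivial] at hge ⊢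
  linarith

open Matrix in
/-- Perron–Frobenius: a positive semidefinite connected matrix with nonpositive off-diagonal
entries has no nonzero kernel vector whose entries sum to zero. -/
theorem Matrix.PosSemidef.eq_zero_of_sum_eq_zero {ι : Type*} [Fintype ι]
    {B : Matrix ι ι ℝ} (hB : B.PosSemidef) (hoff : ∀ i j, i ≠ j → B i j ≤ 0)
    (hconn : ∀ i j, Relation.ReflTransGen (fun i j => i ≠ j ∧ B i j < 0) i j)
    {w : ι → ℝ} (hker : B *ᵥ w = 0) (hsum : ∑ i, w i = 0) : w = 0 := by
  have hker' : B *ᵥ (|w| + w) = 0 := by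
    rw [mulVec_add, hB.mulVec_abs_eq_zero hoff hker, hker, add_zero]
  have hnn : 0 ≤ |w| + w := fun i => by
    simpa using neg_le_iff_add_nonneg.mp (neg_abs_le (w i) |> neg_le.mp)
  by_cases h : ∃ i, (|w| + w) i = 0
  · obtain ⟨i, hi⟩ := h
    have hz := eq_zero_of_nonneg_of_mulVec_eq_zero hoff hconn hnn hker' hi
    have hle : ∀ j ∈ Finset.univ, w j ≤ 0 := fun j _ => by
      have := congrFun hz j
      simp only [Pi.add_apply, Pi.abs_apply, Pi.zero_apply] at this
      linarith [abs_nonneg (w j)]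
    funext j
    exact (Finset.sum_eq_zero_iff_of_nonpos hle).mp hsum j (Finset.mem_univ j)
  · push Not at h
    have hpos : ∀ j, 0 < w j := fun j => by
      by_contra hj
      exact h j (by simp [abs_of_nonpos (not_lt.mp hj)])
    funext j
    exact (Finset.sum_eq_zero_iff_of_nonneg fun j _ => (hpos j).le).mp hsum j (Finset.mem_univ j)

/-- The diagonal sign `ε ^ |n|` of a configuration `n` with `|n|` excitations. -/
def confSign {N : ℕ} (ε : ℝ) (n : Fin N → Bool) : ℝ :=
  ∏ i, if n i = true then ε else 1

theorem confSign_mul_self {N : ℕ} {ε : ℝ} (hε : ε * ε = 1) (n : Fin N → Bool) :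
    confSign ε n * confSign ε n = 1 := by
  rw [confSign, ← Finset.prod_mul_distrib]
  exact Finset.prod_eq_one fun i _ => by split_ifs <;> simp [hε]

theorem confSign_mul {N : ℕ} {ε : ℝ} (hε : ε * ε = 1) (n n' : Fin N → Bool) :
    confSign ε n * confSign ε n' = ε ^ hammingDist n n' := by
  rw [confSign, confSign, ← Finset.prod_mul_distrib, hammingDist, ← Finset.prod_const,
    Finset.prod_filter]
  refine Finset.prod_congr rfl fun i _ => ?_
  cases n i <;> cases n' i <;> simp [hε]

theorem confSign_confAct {N : ℕ} (ε : ℝ) (φ : Equiv.Perm (Fin N)) (n : Fin N → Bool) :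
    confSign ε (confAct φ n) = confSign ε n :=
  Equiv.prod_comp φ fun i => if n i = true then ε else 1

/-- Conjugating by the diagonal signs `ε ^ |n|` multiplies the fluctuation strength by `ε`. -/
theorem blockadeH_mul_confSign {N : ℕ} (G : SimpleGraph (Fin N)) [DecidableRel G.Adj]
    (Δ : Fin N → ℝ) (U₀ Ω : ℝ) {ε : ℝ} (hε : ε * ε = 1) (n n' : Fin N → Bool) :
    blockadeH G Δ U₀ Ω n n' * confSign ε n' =
      confSign ε n * blockadeH G Δ U₀ (ε * Ω) n n' := by
  simp only [blockadeH, Matrix.of_apply]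
  split_ifs with h1 h2
  · rw [h1, mul_comm]
  · have h := confSign_mul hε n n'
    rw [h2, pow_one] at h
    linear_combination confSign ε n * Ω * h - Ω * confSign ε n' * confSign_mul_self hε n
  · simp

theorem blockadeH_mulVec_confSign_mul {N : ℕ} (G : SimpleGraph (Fin N)) [DecidableRel G.Adj]
    (Δ : Fin N → ℝ) (U₀ Ω : ℝ) {ε : ℝ} (hε : ε * ε = 1) (w : (Fin N → Bool) → ℝ) :
    (blockadeH G Δ U₀ Ω).mulVec (confSign ε * w) =
      confSign ε * (blockadeH G Δ U₀ (ε * Ω)).mulVec w := by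
  funext n
  simp only [Matrix.mulVec, dotProduct, Pi.mul_apply, Finset.mul_sum]
  refine Finset.sum_congr rfl fun n' _ => ?_
  rw [← mul_assoc, blockadeH_mul_confSign G Δ U₀ Ω hε, mul_assoc]

theorem blockadeH_isSymm {N : ℕ} (G : SimpleGraph (Fin N)) [DecidableRel G.Adj]
    (Δ : Fin N → ℝ) (U₀ Ω : ℝ) : (blockadeH G Δ U₀ Ω).IsSymm := by
  ext n n'
  by_cases h : n = n'
  · rw [h, Matrix.transpose_apply]
  · simp [blockadeH, h, Ne.symm h, hammingDist_comm n' n]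

theorem hammingDist_update_le_one {N : ℕ} (n : Fin N → Bool) (i : Fin N) (a : Bool) :
    hammingDist n (Function.update n i a) ≤ 1 := by
  refine (Finset.card_le_card (t := {i}) fun j hj => ?_).trans (Finset.card_singleton i).le
  by_contra hji
  simp_all [Function.update_of_ne]

/-- The hypercube of configurations is connected. -/
theorem reflTransGen_hammingDist_eq_one {N : ℕ} (n m : Fin N → Bool) :
    Relation.ReflTransGen (fun n n' : Fin N → Bool => hammingDist n n' = 1) n m := by
  suffices h : ∀ s : Finset (Fin N), Relation.ReflTransGen
      (fun n n' : Fin N → Bool => hammingDist n n' = 1) n (s.piecewise m n) by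
    simpa using h Finset.univ
  intro s
  induction s using Finset.induction_on with
  | empty => simpa using Relation.ReflTransGen.refl
  | insert i s _ ih =>
    rw [Finset.piecewise_insert]
    rcases Nat.le_one_iff_eq_zero_or_eq_one.mp
      (hammingDist_update_le_one (s.piecewise m n) i (m i)) with h | h
    · rwa [← hammingDist_eq_zero.mp h]
    · exact ih.tail h

theorem two_mul_excitedEdgeCount {N : ℕ} (G : SimpleGraph (Fin N)) [DecidableRel G.Adj]
    (n : Fin N → Bool) :
    2 * excitedEdgeCount G n = (Finset.univ.filter fun p : Fin N × Fin N =>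
      G.Adj p.1 p.2 ∧ n p.1 = true ∧ n p.2 = true).card := by
  rw [← Finset.card_filter_add_card_filter_not (fun p : Fin N × Fin N => p.1 < p.2), two_mul]
  congr 1
  · rw [excitedEdgeCount, Finset.filter_filter]
    congr 1
    ext p
    simp only [Finset.mem_filter]
    tauto
  · rw [excitedEdgeCount, Finset.filter_filter]
    refine Finset.card_equiv (Equiv.prodComm _ _) fun p => ?_
    have := G.adj_comm p.1 p.2
    have hne : G.Adj p.1 p.2 → p.1 ≠ p.2 := fun h => h.ne
    simp only [Finset.mem_filter, Finset.mem_univ, true_and, Equiv.prodComm_apply, Prod.fst_swap,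
      Prod.snd_swap, not_lt]
    grind

theorem excitedEdgeCount_confAct {N : ℕ} (G : SimpleGraph (Fin N)) [DecidableRel G.Adj]
    {φ : Equiv.Perm (Fin N)} (hAdj : ∀ i j, G.Adj (φ i) (φ j) ↔ G.Adj i j)
    (n : Fin N → Bool) : excitedEdgeCount G (confAct φ n) = excitedEdgeCount G n := by
  refine Nat.eq_of_mul_eq_mul_left two_pos ?_
  rw [two_mul_excitedEdgeCount, two_mul_excitedEdgeCount]
  exact Finset.card_equiv (φ.prodCongr φ) fun p => by
    rw [Finset.mem_filter, Finset.mem_filter]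
    simp [hAdj, confAct]

theorem hammingDist_confAct {N : ℕ} (φ : Equiv.Perm (Fin N)) (n n' : Fin N → Bool) :
    hammingDist (confAct φ n) (confAct φ n') = hammingDist n n' :=
  Finset.card_equiv φ fun i => by
    rw [Finset.mem_filter, Finset.mem_filter]
    simp [confAct]

/-- The permutation of configurations induced by a permutation of the vertices. -/
def confPerm {N : ℕ} (φ : Equiv.Perm (Fin N)) : Equiv.Perm (Fin N → Bool) where
  toFun := confAct φ
  invFun := confAct φ.symm
  left_inv n := by funext i; simp [confAct]
  right_inv n := by funext i; simp [confAct]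

theorem blockadeH_confAct {N : ℕ} (G : SimpleGraph (Fin N)) [DecidableRel G.Adj]
    {Δ : Fin N → ℝ} (U₀ Ω : ℝ) {φ : Equiv.Perm (Fin N)} (hΔ : ∀ i, Δ (φ i) = Δ i)
    (hAdj : ∀ i j, G.Adj (φ i) (φ j) ↔ G.Adj i j) (n n' : Fin N → Bool) :
    blockadeH G Δ U₀ Ω (confAct φ n) (confAct φ n') = blockadeH G Δ U₀ Ω n n' := by
  have hinj : confAct φ n = confAct φ n' ↔ n = n' := (confPerm φ).injective.eq_iff
  have hsum : ∑ i, Δ i * (if confAct φ n i = true then (1 : ℝ) else 0) =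
      ∑ i, Δ i * (if n i = true then (1 : ℝ) else 0) := by
    rw [← Equiv.sum_comp φ fun i => Δ i * (if n i = true then (1 : ℝ) else 0)]
    exact Finset.sum_congr rfl fun i _ => by rw [hΔ]; rfl
  simp only [blockadeH, Matrix.of_apply, hinj, hammingDist_confAct, hsum,
    excitedEdgeCount_confAct G hAdj]

theorem blockadeH_mulVec_comp_confAct {N : ℕ} (G : SimpleGraph (Fin N)) [DecidableRel G.Adj]
    {Δ : Fin N → ℝ} (U₀ Ω : ℝ) {φ : Equiv.Perm (Fin N)} (hΔ : ∀ i, Δ (φ i) = Δ i)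
    (hAdj : ∀ i j, G.Adj (φ i) (φ j) ↔ G.Adj i j) (w : (Fin N → Bool) → ℝ) :
    (blockadeH G Δ U₀ Ω).mulVec (w ∘ confAct φ) =
      (blockadeH G Δ U₀ Ω).mulVec w ∘ confAct φ := by
  funext n
  simp only [Matrix.mulVec, dotProduct, Function.comp_apply]
  rw [← Equiv.sum_comp (confPerm φ) fun m => blockadeH G Δ U₀ Ω (confAct φ n) m * w m]
  exact Finset.sum_congr rfl fun m _ => by
    rw [show confPerm φ m = confAct φ m from rfl, blockadeH_confAct G U₀ Ω hΔ hAdj]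

/-- For negative fluctuation strength, an eigenvector for the lowest eigenvalue whose entries
sum to zero vanishes. -/
theorem eq_zero_of_blockadeH_ground_of_sum_eq_zero {N : ℕ} (G : SimpleGraph (Fin N))
    [DecidableRel G.Adj] (Δ : Fin N → ℝ) (U₀ : ℝ) {Ω : ℝ} (hΩ : Ω < 0) {μ : ℝ}
    (hmin : ∀ (c : ℝ) (w : (Fin N → Bool) → ℝ), w ≠ 0 →
      (blockadeH G Δ U₀ Ω).mulVec w = c • w → μ ≤ c)
    {w : (Fin N → Bool) → ℝ} (heig : (blockadeH G Δ U₀ Ω).mulVec w = μ • w)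
    (hsum : ∑ n, w n = 0) : w = 0 := by
  have hentry : ∀ n n', n ≠ n' → (blockadeH G Δ U₀ Ω - μ • 1) n n' =
      if hammingDist n n' = 1 then Ω else 0 := fun n n' h => by
    simp [blockadeH, h]
  refine ((blockadeH_isSymm G Δ U₀ Ω).posSemidef_sub_smul_one hmin).eq_zero_of_sum_eq_zero
    (fun n n' h => ?_) (fun n n' => ?_) ?_ hsum
  · rw [hentry n n' h]
    split_ifs
    exacts [hΩ.le, le_rfl]
  · refine Relation.ReflTransGen.mono (fun a b hab => ?_) _ _ (reflTransGen_hammingDist_eq_one n n')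
    have hne : a ≠ b := hammingDist_ne_zero.mp (by omega)
    exact ⟨hne, by rwa [hentry a b hne, if_pos hab]⟩
  · rw [Matrix.sub_mulVec, heig, Matrix.smul_mulVec, Matrix.one_mulVec, sub_self]

/-- If `Ω ≠ 0` and `φ` is an automorphism of `(G, Δ)`, every ground eigenvector `v` of
`H(Ω)` satisfies `U_φ v = v` exactly; equivalently `v_{φ·n} = v_n` for every configuration,
so the entries of a ground eigenvector are constant on orbits. -/
theorem blockadeH_ground_state_symmetric {N : ℕ} (G : SimpleGraph (Fin N))
    [DecidableRel G.Adj] (Δ : Fin N → ℝ) (U₀ Ω : ℝ) (hΩ : Ω ≠ 0)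
    (φ : Equiv.Perm (Fin N))
    (hΔ : ∀ i, Δ (φ i) = Δ i)
    (hAdj : ∀ i j, G.Adj (φ i) (φ j) ↔ G.Adj i j) (μ : ℝ)
    (hmin : ∀ μ' : ℝ,
      Module.End.HasEigenvalue (Matrix.toLin' (blockadeH G Δ U₀ Ω)) μ' → μ ≤ μ')
    (v : (Fin N → Bool) → ℝ) (hv : v ≠ 0)
    (heig : (blockadeH G Δ U₀ Ω).mulVec v = μ • v) :
    (permMatrix ℝ φ).mulVec v = v ∧ ∀ n : Fin N → Bool, v (confAct φ n) = v n := by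
  have hinv : ∀ n, v (confAct φ n) = v n := by
    obtain ⟨ε, hε, hneg⟩ : ∃ ε : ℝ, ε * ε = 1 ∧ ε * Ω < 0 := by
      rcases lt_or_gt_of_ne hΩ with h | h
      exacts [⟨1, by norm_num, by linarith⟩, ⟨-1, by norm_num, by linarith⟩]
    have hmin' : ∀ (c : ℝ) (w : (Fin N → Bool) → ℝ), w ≠ 0 →
        (blockadeH G Δ U₀ (ε * Ω)).mulVec w = c • w → μ ≤ c := by
      intro c w hw hc
      refine hmin c (Module.End.hasEigenvalue_of_hasEigenvector (x := confSign ε * w)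
        ⟨Module.End.mem_eigenspace_iff.mpr ?_, fun h0 => hw ?_⟩)
      · rw [Matrix.toLin'_apply, blockadeH_mulVec_confSign_mul G Δ U₀ Ω hε, hc, mul_smul_comm]
      · funext n
        have h := congrFun h0 n
        exact (mul_eq_zero.mp h).resolve_left
          (left_ne_zero_of_mul_eq_one (confSign_mul_self hε n))
    have hεΩ : ε * (ε * Ω) = Ω := by rw [← mul_assoc, hε, one_mul]
    have hw : (blockadeH G Δ U₀ (ε * Ω)).mulVec (confSign ε * v) = μ • (confSign ε * v) := by
      rw [blockadeH_mulVec_confSign_mul G Δ U₀ _ hε, hεΩ, heig, mul_smul_comm]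
    have hzero : (confSign ε * v) ∘ confAct φ - confSign ε * v = 0 := by
      refine eq_zero_of_blockadeH_ground_of_sum_eq_zero G Δ U₀ hneg hmin' ?_ ?_
      · rw [Matrix.mulVec_sub, blockadeH_mulVec_comp_confAct G U₀ _ hΔ hAdj, hw, smul_sub]
        rfl
      · simp only [Pi.sub_apply, Finset.sum_sub_distrib]
        exact sub_eq_zero.mpr (Equiv.sum_comp (confPerm φ) (confSign ε * v))
    intro n
    have h := sub_eq_zero.mp (congrFun hzero n)
    simp only [Function.comp_apply, Pi.mul_apply, confSign_confAct] at h
    exact mul_left_cancel₀ (left_ne_zero_of_mul_eq_one (confSign_mul_self hε n)) h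
  refine ⟨funext fun m => ?_, hinv⟩
  obtain ⟨n, rfl⟩ := (confPerm φ).surjective m
  change ∑ k, (if confAct φ n = confAct φ k then (1 : ℝ) else 0) * v k = v (confAct φ n)
  have hinj : ∀ k, confAct φ n = confAct φ k ↔ n = k := fun k => (confPerm φ).injective.eq_iff
  simp [hinj, hinv]
end

section
/- Let H({Ω_i}) be the variant of the blockade Hamiltonian whose off-diagonal entry between two configurations that differ exactly in component i equals Ω_i (with the same diagonal entries as H). If Ω_i ≠ 0 for every site i, then the eigenspace of H({Ω_i}) for its minimal eigenvalue is one-dimensional, and every entry of the corresponding ground eigenvector is nonzero. -/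
/-- The blockade Hamiltonian with site-dependent fluctuation strengths `Ω_i`: diagonal
entries as for `H`, off-diagonal entry `Ω_i` between configurations differing exactly in
component `i`, and `0` between configurations differing in two or more components. -/
noncomputable def blockadeHsite {N : ℕ} (G : SimpleGraph (Fin N)) [DecidableRel G.Adj]
    (Δ : Fin N → ℝ) (U₀ : ℝ) (Ω : Fin N → ℝ) :
    Matrix (Fin N → Bool) (Fin N → Bool) ℝ :=
  Matrix.of fun n n' =>
    if n = n' then
      U₀ * (excitedEdgeCount G n : ℝ) - ∑ i, Δ i * (if n i = true then (1 : ℝ) else 0)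
    else ∑ i, if n' = Function.update n i (!(n i)) then Ω i else 0

namespace Matrix

variable {ι : Type*} [Fintype ι] [DecidableEq ι]

/-- A real Hermitian matrix minus a lower bound of its eigenvalues is positive semidefinite. -/
lemma IsHermitian.posSemidef_sub_smul_one {A : Matrix ι ι ℝ} (hA : A.IsHermitian) {μ : ℝ}
    (hmin : ∀ μ' : ℝ, Module.End.HasEigenvalue (Matrix.toLin' A) μ' → μ ≤ μ') :
    (A - μ • (1 : Matrix ι ι ℝ)).PosSemidef := by
  have hB : (A - μ • (1 : Matrix ι ι ℝ)).IsHermitian := by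
    refine hA.sub ?_
    simp [IsHermitian]
  rw [hB.posSemidef_iff_eigenvalues_nonneg]
  intro j
  have hj := hB.mulVec_eigenvectorBasis j
  have hne : (hB.eigenvectorBasis j).ofLp ≠ 0 := by
    intro h
    exact hB.eigenvectorBasis.toBasis.ne_zero j (by
      ext i
      simpa using congrFun h i)
  have hev : Module.End.HasEigenvalue (Matrix.toLin' A) (hB.eigenvalues j + μ) := by
    refine Module.End.hasEigenvalue_of_hasEigenvector
      (x := (hB.eigenvectorBasis j).ofLp) ⟨?_, hne⟩
    rw [Module.End.mem_eigenspace_iff, Matrix.toLin'_apply, add_smul, ← hj, sub_mulVec,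
      smul_mulVec, one_mulVec]
    abel
  have := hmin _ hev
  simp only [Pi.zero_apply]
  linarith

/-- Gauge-twisted absolute values of a ground vector form a ground vector. -/
lemma mulVec_gauge_abs {A : Matrix ι ι ℝ} {μ : ℝ}
    (hpos : (A - μ • (1 : Matrix ι ι ℝ)).PosSemidef) {s : ι → ℝ} (hs : ∀ a, s a * s a = 1)
    (hsA : ∀ a b, a ≠ b → s a * A a b * s b = -|A a b|)
    {v : ι → ℝ} (hv : A *ᵥ v = μ • v) :
    A *ᵥ (fun a => s a * |v a|) = μ • fun a => s a * |v a| := by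
  set w : ι → ℝ := fun a => s a * |v a| with hw
  have key : w ⬝ᵥ (A *ᵥ w) ≤ v ⬝ᵥ (A *ᵥ v) := by
    simp only [dotProduct, mulVec, Finset.mul_sum]
    refine Finset.sum_le_sum fun a _ => Finset.sum_le_sum fun b _ => ?_
    by_cases hab : a = b
    · subst hab
      have h1 : w a * (A a a * w a) = (s a * s a) * A a a * (|v a| * |v a|) := by
        simp only [hw]; ring
      rw [h1, hs, abs_mul_abs_self]
      exact le_of_eq (by ring)
    · have h1 : w a * (A a b * w b) = (s a * A a b * s b) * (|v a| * |v b|) := by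
        simp only [hw]; ring
      have h2 : -|A a b| * (|v a| * |v b|) = -|v a * (A a b * v b)| := by
        simp only [abs_mul]; ring
      rw [h1, hsA a b hab, h2]
      exact neg_abs_le _
  have hnorm : w ⬝ᵥ w = v ⬝ᵥ v := by
    refine Finset.sum_congr rfl fun a _ => ?_
    have h1 : w a * w a = (s a * s a) * (|v a| * |v a|) := by simp only [hw]; ring
    rw [h1, hs, abs_mul_abs_self, one_mul]
  have hsub : (A - μ • (1 : Matrix ι ι ℝ)) *ᵥ w = A *ᵥ w - μ • w := by
    rw [sub_mulVec, smul_mulVec, one_mulVec]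
  have hzero : star w ⬝ᵥ ((A - μ • (1 : Matrix ι ι ℝ)) *ᵥ w) = 0 := by
    refine le_antisymm ?_ (hpos.dotProduct_mulVec_nonneg w)
    rw [hv, dotProduct_smul, ← hnorm] at key
    rw [star_trivial, hsub, dotProduct_sub, dotProduct_smul]
    exact sub_nonpos.2 key
  rw [hpos.dotProduct_mulVec_zero_iff, hsub] at hzero
  exact sub_eq_zero.1 hzero

/-- A ground vector of an irreducible stoquastic matrix (up to gauge) with a zero entry
vanishes. -/
lemma eq_zero_of_ground_of_apply_eq_zero {A : Matrix ι ι ℝ} {μ : ℝ}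
    (hpos : (A - μ • (1 : Matrix ι ι ℝ)).PosSemidef) {s : ι → ℝ} (hs : ∀ a, s a * s a = 1)
    (hsA : ∀ a b, a ≠ b → s a * A a b * s b = -|A a b|)
    (hconn : ∀ a b, Relation.ReflTransGen (fun a b => A a b ≠ 0) a b)
    {v : ι → ℝ} (hv : A *ᵥ v = μ • v) {a : ι} (ha : v a = 0) : v = 0 := by
  have hw := mulVec_gauge_abs hpos hs hsA hv
  have step : ∀ a b, A a b ≠ 0 → v a = 0 → v b = 0 := by
    intro a b hab ha
    have hsum := congrArg (fun x => s a * x) (congrFun hw a)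
    simp only [mulVec, dotProduct, Pi.smul_apply, ha, abs_zero, mul_zero, smul_zero,
      Finset.mul_sum] at hsum
    have hterm : ∀ c, s a * (A a c * (s c * |v c|)) = -(|A a c| * |v c|) := by
      intro c
      by_cases hac : a = c
      · subst hac; simp [ha]
      · rw [← neg_mul, ← hsA a c hac]; ring
    simp only [hterm, Finset.sum_neg_distrib, neg_eq_zero] at hsum
    have := (Finset.sum_eq_zero_iff_of_nonneg fun c _ => by positivity).1 hsum b
      (Finset.mem_univ b)
    simpa [hab] using this
  funext b
  induction hconn a b with
  | refl => exact ha
  | tail _ hbc ih => exact step _ _ hbc ih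

/-- Perron–Frobenius for ground states: nondegeneracy and absence of zero entries. -/
theorem ground_state_unique {A : Matrix ι ι ℝ} (hA : A.IsHermitian) {s : ι → ℝ}
    (hs : ∀ a, s a * s a = 1) (hsA : ∀ a b, a ≠ b → s a * A a b * s b = -|A a b|)
    (hconn : ∀ a b, Relation.ReflTransGen (fun a b => A a b ≠ 0) a b) {μ : ℝ}
    (hμ : Module.End.HasEigenvalue (Matrix.toLin' A) μ)
    (hmin : ∀ μ' : ℝ, Module.End.HasEigenvalue (Matrix.toLin' A) μ' → μ ≤ μ') :
    Module.finrank ℝ (Module.End.eigenspace (Matrix.toLin' A) μ) = 1 ∧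
      ∀ v : ι → ℝ, v ≠ 0 → A *ᵥ v = μ • v → ∀ a, v a ≠ 0 := by
  have hpos := hA.posSemidef_sub_smul_one hmin
  have hne : ∀ v : ι → ℝ, v ≠ 0 → A *ᵥ v = μ • v → ∀ a, v a ≠ 0 := fun v hv0 hv a ha =>
    hv0 (eq_zero_of_ground_of_apply_eq_zero hpos hs hsA hconn hv ha)
  refine ⟨?_, hne⟩
  obtain ⟨v, hv, hv0⟩ := hμ.exists_hasEigenvector
  obtain ⟨a, -⟩ := Function.ne_iff.1 hv0
  have hv' : A *ᵥ v = μ • v := by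
    simpa [Module.End.mem_eigenspace_iff] using hv
  have hva := hne v hv0 hv' a
  refine finrank_eq_one_iff'.2 ⟨⟨v, hv⟩, fun h => hv0 (congrArg Subtype.val h), ?_⟩
  rintro ⟨u, hu⟩
  have hu' : A *ᵥ u = μ • u := by
    simpa [Module.End.mem_eigenspace_iff] using hu
  refine ⟨u a / v a, Subtype.ext ?_⟩
  have hd : A *ᵥ ((u a / v a) • v - u) = μ • ((u a / v a) • v - u) := by
    rw [mulVec_sub, mulVec_smul, hv', hu', smul_sub, smul_comm]
  have := eq_zero_of_ground_of_apply_eq_zero hpos hs hsA hconn hd (a := a) (by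
    simp [hva])
  exact sub_eq_zero.1 this

end Matrix

section Flip

variable {ι : Type*} [DecidableEq ι]

lemma update_not_injective (n : ι → Bool) :
    Function.Injective fun i => Function.update n i (!(n i)) := by
  intro i j hij
  by_contra hne
  have := congrFun hij i
  simp [Function.update_of_ne hne] at this

lemma ne_update_not (n : ι → Bool) (i : ι) : n ≠ Function.update n i (!(n i)) := by
  intro h
  have := congrFun h i
  simp at this

lemma eq_update_not_comm (n m : ι → Bool) (i : ι) :
    m = Function.update n i (!(n i)) ↔ n = Function.update m i (!(m i)) := by
  constructor <;> rintro rfl <;> simp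

/-- Any two configurations are connected by single-site flips. -/
lemma reflTransGen_update_not [Fintype ι] (n m : ι → Bool) :
    Relation.ReflTransGen (fun a b => ∃ i, b = Function.update a i (!(a i))) n m := by
  suffices h : ∀ t : Finset ι, Relation.ReflTransGen
      (fun a b : ι → Bool => ∃ i, b = Function.update a i (!(a i))) n (t.piecewise m n) by
    simpa using h Finset.univ
  intro t
  induction t using Finset.induction_on with
  | empty => simpa using Relation.ReflTransGen.refl
  | insert i t _ ih =>
    rw [Finset.piecewise_insert]
    by_cases h : m i = t.piecewise m n i
    · rwa [h, Function.update_eq_self]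
    · exact ih.tail ⟨i, by rw [Bool.eq_not_of_ne h]⟩

end Flip

section Blockade

variable {N : ℕ} (G : SimpleGraph (Fin N)) [DecidableRel G.Adj] (Δ : Fin N → ℝ) (U₀ : ℝ)
  (Ω : Fin N → ℝ)

lemma blockadeHsite_apply_update_not (n : Fin N → Bool) (i : Fin N) :
    blockadeHsite G Δ U₀ Ω n (Function.update n i (!(n i))) = Ω i := by
  rw [blockadeHsite, Matrix.of_apply, if_neg (ne_update_not n i), Finset.sum_eq_single i]
  · simp
  · intro j _ hj
    exact if_neg fun h => hj (update_not_injective n h.symm)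
  · simp

lemma blockadeHsite_apply_eq_zero {n m : Fin N → Bool} (hnm : n ≠ m)
    (h : ∀ i, m ≠ Function.update n i (!(n i))) : blockadeHsite G Δ U₀ Ω n m = 0 := by
  rw [blockadeHsite, Matrix.of_apply, if_neg hnm]
  exact Finset.sum_eq_zero fun i _ => if_neg (h i)

lemma blockadeHsite_isHermitian : (blockadeHsite G Δ U₀ Ω).IsHermitian := by
  ext n m
  rw [Matrix.conjTranspose_apply, star_trivial]
  by_cases h : n = m
  · rw [h]
  · simp only [blockadeHsite, Matrix.of_apply, if_neg h, if_neg (Ne.symm h),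
      eq_update_not_comm m n]

/-- The sign gauge making all off-diagonal entries of the Hamiltonian nonpositive. -/
noncomputable def blockadeGauge (n : Fin N → Bool) : ℝ :=
  ∏ i, if n i = true then (if 0 < Ω i then (-1 : ℝ) else 1) else 1

lemma blockadeGauge_mul_self (n : Fin N → Bool) :
    blockadeGauge Ω n * blockadeGauge Ω n = 1 := by
  rw [blockadeGauge, ← Finset.prod_mul_distrib]
  refine Finset.prod_eq_one fun i _ => ?_
  split_ifs <;> norm_num

lemma blockadeGauge_mul_update_not (n : Fin N → Bool) (i : Fin N) :
    blockadeGauge Ω n * blockadeGauge Ω (Function.update n i (!(n i))) =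
      if 0 < Ω i then -1 else 1 := by
  rw [blockadeGauge, blockadeGauge, ← Finset.prod_mul_distrib, Finset.prod_eq_single i]
  · cases h : n i <;> simp
  · intro j _ hj
    rw [Function.update_of_ne hj]
    split_ifs <;> norm_num
  · simp

lemma blockadeGauge_mul_blockadeHsite_mul {n m : Fin N → Bool} (hnm : n ≠ m) :
    blockadeGauge Ω n * blockadeHsite G Δ U₀ Ω n m * blockadeGauge Ω m =
      -|blockadeHsite G Δ U₀ Ω n m| := by
  by_cases h : ∃ i, m = Function.update n i (!(n i))
  · obtain ⟨i, rfl⟩ := h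
    rw [blockadeHsite_apply_update_not, mul_right_comm, blockadeGauge_mul_update_not]
    split_ifs with hi
    · rw [abs_of_pos hi, neg_one_mul]
    · rw [abs_of_nonpos (not_lt.1 hi), neg_neg, one_mul]
  · rw [blockadeHsite_apply_eq_zero G Δ U₀ Ω hnm (not_exists.1 h)]
    simp

end Blockade

/-- If `Ω_i ≠ 0` for every site `i`, the eigenspace of `H({Ω_i})` for its minimal eigenvalue
is one-dimensional, and every entry of the corresponding ground eigenvector is nonzero. -/
theorem blockadeHsite_ground_state_unique {N : ℕ} (G : SimpleGraph (Fin N))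
    [DecidableRel G.Adj] (Δ : Fin N → ℝ) (U₀ : ℝ) (Ω : Fin N → ℝ)
    (hΩ : ∀ i, Ω i ≠ 0) (μ : ℝ)
    (hμ : Module.End.HasEigenvalue (Matrix.toLin' (blockadeHsite G Δ U₀ Ω)) μ)
    (hmin : ∀ μ' : ℝ,
      Module.End.HasEigenvalue (Matrix.toLin' (blockadeHsite G Δ U₀ Ω)) μ' → μ ≤ μ') :
    Module.finrank ℝ
      (Module.End.eigenspace (Matrix.toLin' (blockadeHsite G Δ U₀ Ω)) μ) = 1 ∧
    ∀ v : (Fin N → Bool) → ℝ, v ≠ 0 →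
      (blockadeHsite G Δ U₀ Ω).mulVec v = μ • v →
      ∀ n : Fin N → Bool, v n ≠ 0 := by
  refine Matrix.ground_state_unique (blockadeHsite_isHermitian G Δ U₀ Ω)
    (blockadeGauge_mul_self Ω)
    (fun _ _ => blockadeGauge_mul_blockadeHsite_mul G Δ U₀ Ω) (fun n m => ?_) hμ hmin
  refine Relation.ReflTransGen.mono ?_ n m (reflTransGen_update_not n m)
  rintro a _ ⟨i, rfl⟩
  rw [blockadeHsite_apply_update_not]
  exact hΩ i
end

section
/- Let H be a Hermitian matrix over ℂ on a finite index set whose minimal eigenvalue E₀ has a one-dimensional eigenspace spanned by a vector v. Let (U_p)_{p ∈ P} be a finite family of self-adjoint unitary involutions (U_p² = 1, U_p† = U_p) that pairwise commute, commute with H, and satisfy U_p v = v for every p. Then for every ω > 0, the matrix H̃ := H + (ω/2) Σ_{p∈P} (1 − U_p) has the same minimal eigenvalue E₀, and the eigenspace of H̃ for its minimal eigenvalue is exactly the span of v. -/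
open scoped ComplexOrder in
/-- A Hermitian matrix all of whose real eigenvalues are at least `E` satisfies `E ≤ H` in the
Loewner order. -/
theorem Matrix.IsHermitian.posSemidef_sub_smul_one_s9 {ι : Type*} [Fintype ι] [DecidableEq ι]
    {H : Matrix ι ι ℂ} (hH : H.IsHermitian) {E : ℝ}
    (hmin : ∀ μ : ℝ, Module.End.HasEigenvalue (Matrix.toLin' H) (μ : ℂ) → E ≤ μ) :
    (H - (E : ℂ) • (1 : Matrix ι ι ℂ)).PosSemidef := by
  have hA : (H - (E : ℂ) • (1 : Matrix ι ι ℂ)).IsHermitian := by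
    refine hH.sub ?_
    simp [Matrix.IsHermitian, Matrix.conjTranspose_smul]
  rw [hA.posSemidef_iff_eigenvalues_nonneg]
  intro i
  have hx := hA.mulVec_eigenvectorBasis i
  set x : ι → ℂ := ⇑(hA.eigenvectorBasis i) with hxdef
  have hx0 : x ≠ 0 := by
    intro h
    apply hA.eigenvectorBasis.toBasis.ne_zero i
    ext j
    simpa using congrFun h j
  have hE : E ≤ E + hA.eigenvalues i := by
    refine hmin _ (Module.End.hasEigenvalue_of_hasEigenvector (x := x) ⟨?_, hx0⟩)
    rw [Module.End.mem_eigenspace_iff, Matrix.toLin'_apply]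
    rw [Matrix.sub_mulVec, Matrix.smul_mulVec, Matrix.one_mulVec, sub_eq_iff_eq_add] at hx
    rw [hx]
    ext j
    simp
    ring
  simpa using hE

open scoped ComplexOrder in
/-- If `U` is a self-adjoint involution, then `1 - U` is positive semidefinite. -/
theorem Matrix.posSemidef_one_sub_of_involution {ι : Type*} [Fintype ι] [DecidableEq ι]
    {U : Matrix ι ι ℂ} (hU2 : U * U = 1) (hUsa : U.conjTranspose = U) :
    ((1 : Matrix ι ι ℂ) - U).PosSemidef := by
  have h : (1 : Matrix ι ι ℂ) - U = (1 / 2 : ℂ) • ((1 - U).conjTranspose * (1 - U)) := by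
    rw [Matrix.conjTranspose_sub, Matrix.conjTranspose_one, hUsa, sub_mul, mul_sub, mul_sub, hU2]
    simp only [one_mul, mul_one]
    module
  rw [h]
  exact (Matrix.posSemidef_conjTranspose_mul_self _).smul (by positivity)

open scoped ComplexOrder in
/-- A vector is in the kernel of a sum of positive semidefinite matrices only if it is in the
kernel of the first summand. -/
theorem Matrix.PosSemidef.mulVec_eq_zero_of_add {ι : Type*} [Fintype ι]
    {A B : Matrix ι ι ℂ} (hA : A.PosSemidef) (hB : B.PosSemidef) {x : ι → ℂ}
    (hx : (A + B).mulVec x = 0) : A.mulVec x = 0 := by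
  rw [← hA.dotProduct_mulVec_zero_iff]
  refine le_antisymm ?_ (hA.dotProduct_mulVec_nonneg x)
  have h : star x ⬝ᵥ (A + B).mulVec x = 0 := by rw [hx, dotProduct_zero]
  rw [Matrix.add_mulVec, dotProduct_add] at h
  rw [← h]
  exact le_add_of_nonneg_right (hB.dotProduct_mulVec_nonneg x)


/-- Let `H` be a Hermitian matrix whose minimal eigenvalue `E₀` has one-dimensional
eigenspace spanned by `v`, and let `(U_p)` be pairwise commuting self-adjoint unitary
involutions commuting with `H` and fixing `v`. Then for every `ω > 0`, the matrix
`H̃ = H + (ω/2) Σ_p (1 − U_p)` has the same minimal eigenvalue `E₀`, with eigenspace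
exactly the span of `v`. -/
theorem perturbed_hamiltonian_same_ground_state
    {ι : Type*} [Fintype ι] [DecidableEq ι]
    (H : Matrix ι ι ℂ) (hH : H.IsHermitian)
    (E₀ : ℝ) (v : ι → ℂ) (hv : v ≠ 0)
    (hspan : Module.End.eigenspace (Matrix.toLin' H) (E₀ : ℂ) = Submodule.span ℂ {v})
    (hmin : ∀ μ : ℝ, Module.End.HasEigenvalue (Matrix.toLin' H) (μ : ℂ) → E₀ ≤ μ)
    {P : Type*} [Fintype P] (U : P → Matrix ι ι ℂ)
    (hU2 : ∀ p, U p * U p = 1)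
    (hUsa : ∀ p, (U p).conjTranspose = U p)
    (hUcomm : ∀ p q, U p * U q = U q * U p)
    (hHU : ∀ p, H * U p = U p * H)
    (hUv : ∀ p, (U p).mulVec v = v)
    (ω : ℝ) (hω : 0 < ω) :
    Module.End.eigenspace
        (Matrix.toLin' (H + ((ω : ℂ) / 2) • ∑ p, ((1 : Matrix ι ι ℂ) - U p))) (E₀ : ℂ)
      = Submodule.span ℂ {v} ∧
    ∀ μ : ℝ, Module.End.HasEigenvalue
        (Matrix.toLin' (H + ((ω : ℂ) / 2) • ∑ p, ((1 : Matrix ι ι ℂ) - U p))) (μ : ℂ) →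
      E₀ ≤ μ := by
  open scoped ComplexOrder in
  have hA := hH.posSemidef_sub_smul_one_s9 hmin
  have hω' : (0 : ℂ) ≤ (ω : ℂ) / 2 := by
    have : (0 : ℂ) ≤ ((ω / 2 : ℝ) : ℂ) := by exact_mod_cast (half_pos hω).le
    simpa using this
  have hB : (((ω : ℂ) / 2) • ∑ p, ((1 : Matrix ι ι ℂ) - U p)).PosSemidef :=
    (Matrix.posSemidef_sum _ fun p _ =>
      Matrix.posSemidef_one_sub_of_involution (hU2 p) (hUsa p)).smul hω'
  have hBv : (((ω : ℂ) / 2) • ∑ p, ((1 : Matrix ι ι ℂ) - U p)).mulVec v = 0 := by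
    rw [Matrix.smul_mulVec, Matrix.sum_mulVec, Finset.sum_eq_zero, smul_zero]
    intro p _
    rw [Matrix.sub_mulVec, Matrix.one_mulVec, hUv, sub_self]
  set B := ((ω : ℂ) / 2) • ∑ p, ((1 : Matrix ι ι ℂ) - U p)
  have hshift (x : ι → ℂ) : (H - (E₀ : ℂ) • (1 : Matrix ι ι ℂ) + B).mulVec x
      = (H + B).mulVec x - (E₀ : ℂ) • x := by
    simp only [Matrix.add_mulVec, Matrix.sub_mulVec, Matrix.smul_mulVec, Matrix.one_mulVec]
    abel
  refine ⟨le_antisymm (fun x hx => ?_) ?_, fun μ hμ => ?_⟩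
  · rw [Module.End.mem_eigenspace_iff, Matrix.toLin'_apply] at hx
    have hAx := hA.mulVec_eq_zero_of_add hB (x := x) (by rw [hshift, hx, sub_self])
    rw [← hspan, Module.End.mem_eigenspace_iff, Matrix.toLin'_apply, ← sub_eq_zero]
    simpa [Matrix.sub_mulVec, Matrix.smul_mulVec] using hAx
  · have hHv : v ∈ Module.End.eigenspace (Matrix.toLin' H) (E₀ : ℂ) :=
      hspan ▸ Submodule.mem_span_singleton_self v
    rw [Module.End.mem_eigenspace_iff, Matrix.toLin'_apply] at hHv
    rw [Submodule.span_singleton_le_iff_mem, Module.End.mem_eigenspace_iff, Matrix.toLin'_apply,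
      Matrix.add_mulVec, hHv, hBv, add_zero]
  · obtain ⟨x, hx, hx0⟩ := hμ.exists_hasEigenvector
    rw [Module.End.mem_eigenspace_iff, Matrix.toLin'_apply] at hx
    have hnonneg := (hA.add hB).dotProduct_mulVec_nonneg x
    rw [hshift, hx, ← sub_smul, dotProduct_smul, smul_eq_mul] at hnonneg
    have hre : 0 ≤ (μ - E₀) * (star x ⬝ᵥ x).re := by
      simpa [Complex.mul_re] using (Complex.nonneg_iff.mp hnonneg).1
    have hpos := (Complex.pos_iff.mp (Matrix.dotProduct_star_self_pos_iff.mpr hx0)).1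
    exact sub_nonneg.mp (nonneg_of_mul_nonneg_left hre hpos)
end
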